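/- Let X be a tree (a connected acyclic graph) and let F be a homological coefficient system of modules on X (a module F(τ) for each vertex and edge τ, with a transition map r^τ_x : F(τ) → F(x) for each vertex x of each edge τ). If all transition maps r^τ_x are injective, then for every vertex y the natural map F(y) → H_0(X, F) is injective, where H_0(X, F) is the cokernel of the map ⊕_{edges τ} F(τ) → ⊕_{vertices x} F(x) sending f ∈ F(τ) to Σ_{x ∈ τ} r^τ_x(f). -/

import Mathlib

open DirectSum

/-- In a tree, a vertex has at most one neighbour closer to a given root. -/
lemma SimpleGraph.IsTree.eq_of_adj_of_dist_eq_add_one {V : Type*} {G : SimpleGraph V}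
    (hG : G.IsTree) {y x u v : V} (hu : G.Adj u x) (hv : G.Adj v x)
    (hdu : G.dist y x = G.dist y u + 1) (hdv : G.dist y x = G.dist y v + 1) : u = v := by
  obtain ⟨p, hp⟩ := hG.connected.exists_walk_length_eq_dist y u
  obtain ⟨q, hq⟩ := hG.connected.exists_walk_length_eq_dist y v
  have hp' : (p.concat hu).IsPath :=
    Walk.isPath_of_length_eq_dist _ (by rw [Walk.length_concat, hp, hdu])
  have hq' : (q.concat hv).IsPath :=
    Walk.isPath_of_length_eq_dist _ (by rw [Walk.length_concat, hq, hdv])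
  have h := congrArg Walk.penultimate
    ((hG.existsUnique_path y x).unique hp' hq')
  simpa using h

/-- A nonempty finite set of edges of a tree with a chosen root `y` contains an edge having an
endpoint other than `y` that lies on no other edge of the set. -/
lemma SimpleGraph.IsTree.exists_mem_forall_mem_eq {V : Type*} {G : SimpleGraph V}
    (hG : G.IsTree) (y : V) {s : Finset G.edgeSet} (hs : s.Nonempty) :
    ∃ e ∈ s, ∃ x ∈ (e : Sym2 V), x ≠ y ∧ ∀ e' ∈ s, x ∈ (e' : Sym2 V) → e' = e := by
  let height : Sym2 V → ℕ :=
    Sym2.lift ⟨fun a b ↦ max (G.dist y a) (G.dist y b), fun a b ↦ max_comm _ _⟩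
  obtain ⟨e, hes, hmax⟩ := s.exists_max_image (fun e ↦ height e) hs
  obtain ⟨a, b, he, hab⟩ : ∃ a b, (e : Sym2 V) = s(a, b) ∧ G.dist y b = G.dist y a + 1 := by
    obtain ⟨e, h⟩ := e
    induction e with
    | h a b =>
      rcases hG.dist_eq_dist_add_one_of_adj y (G.mem_edgeSet.mp h) with h' | h'
      · exact ⟨b, a, Sym2.eq_swap, h'⟩
      · exact ⟨a, b, rfl, h'⟩
  have hadj : G.Adj a b := by
    rw [← G.mem_edgeSet, ← he]
    exact e.2
  refine ⟨e, hes, b, by simp [he], ?_, fun e' hes' hb ↦ ?_⟩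
  · rintro rfl
    simp at hab
  · obtain ⟨c, hc⟩ := hb
    have hcb : G.Adj b c := by
      rw [← G.mem_edgeSet, ← hc]
      exact e'.2
    have hle : max (G.dist y b) (G.dist y c) ≤ max (G.dist y a) (G.dist y b) := by
      simpa only [height, hc, he, Sym2.lift_mk] using hmax e' hes'
    have hbc : G.dist y b = G.dist y c + 1 := by
      rcases hG.dist_eq_dist_add_one_of_adj y hcb with h | h <;> omega
    have hca := hG.eq_of_adj_of_dist_eq_add_one hcb.symm hadj hbc hab
    exact Subtype.ext (by rw [hc, he, hca, Sym2.eq_swap])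

/-- Let `X` be a tree and `F` a homological coefficient system of
modules on `X` with injective transition maps. Then for every vertex `y` the natural
map `F(y) → H₀(X, F)` is injective, where `H₀(X, F)` is the cokernel of the
differential `⊕_τ F(τ) → ⊕_x F(x)`, `f ↦ Σ_{x ∈ τ} r^τ_x f`. -/
theorem stmt0 {V : Type} [DecidableEq V] (G : SimpleGraph V) (hT : G.IsTree)
    (R : Type) [CommRing R]
    (F0 : V → Type) [∀ v, AddCommGroup (F0 v)] [∀ v, Module R (F0 v)]
    (F1 : G.edgeSet → Type) [∀ e, AddCommGroup (F1 e)] [∀ e, Module R (F1 e)]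
    (r : ∀ (e : G.edgeSet) (v : V), v ∈ (e : Sym2 V) → (F1 e →ₗ[R] F0 v))
    (hinj : ∀ e v h, Function.Injective (r e v h))
    (d : (⨁ e, F1 e) →ₗ[R] ⨁ v, F0 v)
    (hd : ∀ (a b : V) (hab : G.Adj a b) (f : F1 ⟨s(a, b), (G.mem_edgeSet).mpr hab⟩),
      d (DirectSum.lof R G.edgeSet F1 ⟨s(a, b), (G.mem_edgeSet).mpr hab⟩ f)
        = DirectSum.lof R V F0 a
            (r ⟨s(a, b), (G.mem_edgeSet).mpr hab⟩ a (Sym2.mem_mk_left a b) f)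
          + DirectSum.lof R V F0 b
            (r ⟨s(a, b), (G.mem_edgeSet).mpr hab⟩ b (Sym2.mem_mk_right a b) f))
    (y : V) :
    Function.Injective ((LinearMap.range d).mkQ ∘ₗ DirectSum.lof R V F0 y) := by
  classical
  have hnot : ∀ (e : G.edgeSet) (f : F1 e) (x : V), x ∉ (e : Sym2 V) →
      d (DirectSum.lof R G.edgeSet F1 e f) x = 0 := by
    rintro ⟨e, he⟩ f x hx
    induction e with
    | h a b =>
      have hx' : x ≠ a ∧ x ≠ b := by simpa [not_or] using hx
      rw [hd a b he f, DirectSum.add_apply, DirectSum.lof_eq_of, DirectSum.lof_eq_of,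
        DirectSum.of_eq_of_ne _ _ _ hx'.1, DirectSum.of_eq_of_ne _ _ _ hx'.2, add_zero]
  have hmem : ∀ (e : G.edgeSet) (f : F1 e) (x : V) (hx : x ∈ (e : Sym2 V)),
      d (DirectSum.lof R G.edgeSet F1 e f) x = r e x hx f := by
    rintro ⟨e, he⟩ f x hx
    induction e with
    | h a b =>
      have hne : a ≠ b := G.ne_of_adj he
      rw [hd a b he f, DirectSum.add_apply, DirectSum.lof_eq_of, DirectSum.lof_eq_of]
      rcases Sym2.mem_iff.mp hx with rfl | rfl
      · rw [DirectSum.of_eq_same, DirectSum.of_eq_of_ne _ _ _ hne, add_zero]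
      · rw [DirectSum.of_eq_same, DirectSum.of_eq_of_ne _ _ _ hne.symm, zero_add]
  rw [injective_iff_map_eq_zero]
  intro m hm
  obtain ⟨w, hw⟩ : DirectSum.lof R V F0 y m ∈ LinearMap.range d := by
    simpa using hm
  obtain rfl : w = 0 := by
    by_contra hw0
    have hs : w.support.Nonempty :=
      Finset.nonempty_iff_ne_empty.mpr (mt DFinsupp.support_eq_empty.mp hw0)
    obtain ⟨e, hes, x, hx, hxy, huniq⟩ := hT.exists_mem_forall_mem_eq y hs
    have hdx : d w x = r e x hx (w e) := by
      conv_lhs => rw [← DirectSum.sum_support_of w]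
      rw [map_sum, DFinsupp.finsetSum_apply, Finset.sum_eq_single_of_mem e hes]
      · exact hmem e (w e) x hx
      · exact fun e' hes' hne ↦ hnot e' (w e') x fun h ↦ hne (huniq e' hes' h)
    rw [hw, DirectSum.lof_eq_of, DirectSum.of_eq_of_ne _ _ _ hxy] at hdx
    exact DFinsupp.mem_support_iff.mp hes
      ((injective_iff_map_eq_zero _).mp (hinj e x hx) _ hdx.symm)
  rw [map_zero, DirectSum.lof_eq_of] at hw
  exact DirectSum.of_injective y (by rw [← hw, map_zero])
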